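/- Let φ be a BDT over the variables x₁, …, xₙ and let ℬ = B(⟦φ⟧) be the BDT slicing of its λ⊕⊸ encoding ⟦φ⟧. Then: (i) ℬ[β, β^l] = φ; (ii) ℬ[β, β^r] = φ̄, the negation of φ obtained by swapping the 0/1 labels of its leaves; (iii) for every i, ℬ[α_i^l, α_i^⊸] ∼ (x_i ? 1 : 0); and (iv) for every i, ℬ[α_i^r, α_i^⊸] ∼ (x_i ? 0 : 1). -/

import Mathlib

/-- Formulas of the intuitionistic multiplicative-additive calculus λ⊕⊸:
atoms, labeled sums `⊕ₓ`, and linear implication `⊸`. -/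
inductive Formula : Type
  | atom : ℕ → Formula
  | oplus : ℕ → Formula → Formula → Formula
  | limp : Formula → Formula → Formula
deriving DecidableEq

namespace Formula

/-- Number of atom occurrences of a formula. -/
def size : Formula → ℕ
  | atom _ => 1
  | oplus _ A B => A.size + B.size
  | limp A B => A.size + B.size

/-- The list of Boolean-variable labels of the `⊕` occurrences of a formula. -/
def labels : Formula → List ℕ
  | atom _ => []
  | oplus x A B => x :: (A.labels ++ B.labels)
  | limp A B => A.labels ++ B.labels

end Formula

/-- Number of atom occurrences of a context. -/
def csz (Γ : List Formula) : ℕ := (Γ.map Formula.size).sum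

/-- All labels of `⊕` occurrences of a sequent `Γ ⊢ C`. -/
def seqLabels (Γ : List Formula) (C : Formula) : List ℕ :=
  (Γ.map Formula.labels).flatten ++ C.labels

/-- Cut-free, η-expanded sequent calculus proofs of λ⊕⊸. -/
inductive Proof : List Formula → Formula → Type
  | ax (a : ℕ) : Proof [.atom a] (.atom a)
  | limpR {Γ : List Formula} {A B : Formula} :
      Proof (Γ ++ [A]) B → Proof Γ (.limp A B)
  | limpL {Γ Δ : List Formula} {A B C : Formula} :
      Proof Γ A → Proof (B :: Δ) C → Proof (Γ ++ .limp A B :: Δ) C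
  | ex (Γ₁ Γ₂ Γ₃ : List Formula) (A B : Formula) {C : Formula} :
      Proof (Γ₁ ++ A :: (Γ₂ ++ B :: Γ₃)) C → Proof (Γ₁ ++ B :: (Γ₂ ++ A :: Γ₃)) C
  | oplusR1 (x : ℕ) {Γ : List Formula} {A B : Formula} :
      Proof Γ A → Proof Γ (.oplus x A B)
  | oplusR2 (x : ℕ) {Γ : List Formula} {A B : Formula} :
      Proof Γ B → Proof Γ (.oplus x A B)
  | oplusL (x : ℕ) {Γ : List Formula} {A B C : Formula} :
      Proof (Γ ++ [A]) C → Proof (Γ ++ [B]) C → Proof (Γ ++ [.oplus x A B]) C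

/-- Atom occurrences of a sequent `Γ ⊢ C` are identified with the positions
`0, 1, 2, …` in the left-to-right flattening of `Γ` followed by `C`.
A slice is a finite set of unordered pairs of such positions. -/
abbrev Slice := Finset (Sym2 ℕ)

/-- Reindexing the atom occurrences of a slice along a map of positions. -/
def Slice.reindex (f : ℕ → ℕ) (l : Slice) : Slice := l.image (Sym2.map f)

/-- Position reindex for the exchange rule: maps the positions of the layout
`[a-block][p-block][b-block][q-block]rest` to those of `[a-block][q-block][b-block][p-block]rest`. -/
def swapMap (a p b q : ℕ) (i : ℕ) : ℕ :=
  if i < a then i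
  else if i < a + p then i + q + b
  else if i < a + p + b then i - p + q
  else if i < a + p + b + q then i - p - b
  else i

/-- The slicing 𝒮(π) of a λ⊕⊸ proof. -/
def Proof.slicing : {Γ : List Formula} → {C : Formula} → Proof Γ C → Finset Slice
  | _, _, .ax _ => {({s(0, 1)} : Slice)}
  | _, _, .limpR p => p.slicing
  | _, _, @Proof.limpL Γ _ A _ _ p q =>
      Finset.image₂ (fun l m => l ∪ Slice.reindex (fun i => i + (csz Γ + A.size)) m)
        p.slicing q.slicing
  | _, _, @Proof.ex Γ₁ Γ₂ _ A B _ p =>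
      p.slicing.image (Slice.reindex (swapMap (csz Γ₁) A.size (csz Γ₂) B.size))
  | _, _, .oplusR1 _ p => p.slicing
  | _, _, @Proof.oplusR2 _ Γ A _ p =>
      p.slicing.image (Slice.reindex (fun i => if i < csz Γ then i else i + A.size))
  | _, _, @Proof.oplusL _ Γ A B _ p q =>
      p.slicing.image (Slice.reindex (fun i => if i < csz Γ + A.size then i else i + B.size))
      ∪ q.slicing.image (Slice.reindex (fun i => if i < csz Γ then i else i + A.size))

/-- Binary decision trees: leaves labeled `0`/`1` (as `Bool`), inner vertices labeled
by Boolean variables; `node x l r` has left subtree `l` and right subtree `r`. -/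
inductive BDT : Type
  | leaf : Bool → BDT
  | node : ℕ → BDT → BDT → BDT
deriving DecidableEq

namespace BDT

/-- Evaluation of a BDT under a valuation: go left when the variable is `false` (0),
right when it is `true` (1). -/
def eval (v : ℕ → Bool) : BDT → Bool
  | leaf b => b
  | node x l r => if v x then r.eval v else l.eval v

/-- Two BDTs are equivalent when they compute the same Boolean function. -/
def Equiv (φ ψ : BDT) : Prop := ∀ v : ℕ → Bool, φ.eval v = ψ.eval v

/-- Variables occurring in a BDT. -/
def vars : BDT → Finset ℕ
  | leaf _ => ∅
  | node x l r => insert x (l.vars ∪ r.vars)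

/-- A BDT is free when no variable occurs twice on a path from the root to a leaf. -/
def Free : BDT → Prop
  | leaf _ => True
  | node x l r => x ∉ l.vars ∧ x ∉ r.vars ∧ l.Free ∧ r.Free

/-- Negation of a BDT: swap the 0/1 labels at the leaves. -/
def neg : BDT → BDT
  | leaf b => leaf !b
  | node x l r => node x l.neg r.neg

end BDT

/-- The BDT slicing B(π) of a proof, as a function of two atom positions of the
conclusion sequent (it is symmetric in the two positions, and `0` on positions
that do not correspond to a pair of atoms of the sequent). -/
def Proof.bdt : {Γ : List Formula} → {C : Formula} → Proof Γ C → ℕ → ℕ → BDT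
  | _, _, .ax _, i, j =>
      if (i = 0 ∧ j = 1) ∨ (i = 1 ∧ j = 0) then .leaf true else .leaf false
  | _, _, .limpR p, i, j => p.bdt i j
  | _, _, @Proof.limpL Γ _ A _ _ p q, i, j =>
      if i < csz Γ + A.size ∧ j < csz Γ + A.size then p.bdt i j
      else if csz Γ + A.size ≤ i ∧ csz Γ + A.size ≤ j then
        q.bdt (i - (csz Γ + A.size)) (j - (csz Γ + A.size))
      else .leaf false
  | _, _, @Proof.ex Γ₁ Γ₂ _ A B _ p, i, j =>
      p.bdt (swapMap (csz Γ₁) B.size (csz Γ₂) A.size i)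
            (swapMap (csz Γ₁) B.size (csz Γ₂) A.size j)
  | _, _, @Proof.oplusR1 _ Γ A _ p, i, j =>
      if i < csz Γ + A.size ∧ j < csz Γ + A.size then p.bdt i j else .leaf false
  | _, _, @Proof.oplusR2 _ Γ A _ p, i, j =>
      if (i < csz Γ ∨ csz Γ + A.size ≤ i) ∧ (j < csz Γ ∨ csz Γ + A.size ≤ j) then
        p.bdt (if i < csz Γ then i else i - A.size) (if j < csz Γ then j else j - A.size)
      else .leaf false
  | _, _, @Proof.oplusL x Γ A B _ p q, i, j =>
      if ((csz Γ ≤ i ∧ i < csz Γ + A.size) ∧ (csz Γ + A.size ≤ j ∧ j < csz Γ + A.size + B.size)) ∨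
         ((csz Γ ≤ j ∧ j < csz Γ + A.size) ∧ (csz Γ + A.size ≤ i ∧ i < csz Γ + A.size + B.size)) then
        .leaf false
      else if (csz Γ ≤ i ∧ i < csz Γ + A.size) ∨ (csz Γ ≤ j ∧ j < csz Γ + A.size) then
        .node x (p.bdt (if i < csz Γ + A.size then i else i - B.size)
                       (if j < csz Γ + A.size then j else j - B.size)) (.leaf false)
      else if (csz Γ + A.size ≤ i ∧ i < csz Γ + A.size + B.size) ∨
              (csz Γ + A.size ≤ j ∧ j < csz Γ + A.size + B.size) then
        .node x (.leaf false) (q.bdt (if i < csz Γ then i else i - A.size)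
                                     (if j < csz Γ then j else j - A.size))
      else
        .node x (p.bdt (if i < csz Γ + A.size then i else i - B.size)
                       (if j < csz Γ + A.size then j else j - B.size))
                (q.bdt (if i < csz Γ then i else i - A.size)
                       (if j < csz Γ then j else j - A.size))

/-- Smaller element of an unordered pair of positions. -/
def pmin (p : Sym2 ℕ) : ℕ := Sym2.lift ⟨fun a b => min a b, fun a b => min_comm a b⟩ p
/-- Larger element of an unordered pair of positions. -/
def pmax (p : Sym2 ℕ) : ℕ := Sym2.lift ⟨fun a b => max a b, fun a b => max_comm a b⟩ p

/-- The BDT slicing B(π) at an unordered pair of atom positions. -/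
def Proof.bdtAt {Γ : List Formula} {C : Formula} (π : Proof Γ C) (p : Sym2 ℕ) : BDT :=
  π.bdt (pmin p) (pmax p)

/-- The slice obtained by evaluating the BDT slicing of `π` under a valuation `v`:
the set of pairs whose BDT evaluates to `1`. -/
def Proof.vslice {Γ : List Formula} {C : Formula} (π : Proof Γ C) (v : ℕ → Bool) :
    Set (Sym2 ℕ) :=
  {p : Sym2 ℕ | (π.bdtAt p).eval v = true}

/-- The labels of the `⊕†` rules of a proof (its Boolean variables). -/
def Proof.labels : {Γ : List Formula} → {C : Formula} → Proof Γ C → List ℕ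
  | _, _, .ax _ => []
  | _, _, .limpR p => p.labels
  | _, _, .limpL p q => p.labels ++ q.labels
  | _, _, .ex _ _ _ _ _ p => p.labels
  | _, _, .oplusR1 _ p => p.labels
  | _, _, .oplusR2 _ p => p.labels
  | _, _, .oplusL x p q => x :: (p.labels ++ q.labels)

/-- Number of rule occurrences of a proof. -/
def Proof.size : {Γ : List Formula} → {C : Formula} → Proof Γ C → ℕ
  | _, _, .ax _ => 1
  | _, _, .limpR p => p.size + 1
  | _, _, .limpL p q => p.size + q.size + 1
  | _, _, .ex _ _ _ _ _ p => p.size + 1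
  | _, _, .oplusR1 _ p => p.size + 1
  | _, _, .oplusR2 _ p => p.size + 1
  | _, _, .oplusL x p q => p.size + q.size + 1

/-! ### The encoding of binary decision trees as λ⊕⊸ proofs -/

/-- Transport of a proof along an equality of contexts. -/
def Proof.castL {Γ Γ' : List Formula} {C : Formula} (h : Γ = Γ') (p : Proof Γ C) :
    Proof Γ' C :=
  h ▸ p

/-- The atom `β` (we take `β = atom 0`, and `αᵢ = atom i` for `i ≥ 1`). -/
def betaF : Formula := .atom 0

/-- The formula `𝔹 = β ⊕ β`. -/
def boolF : Formula := .oplus 0 betaF betaF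

/-- `Fn n = αₙ ⊸ ⋯ ⊸ α₂ ⊸ α₁ ⊸ β`. -/
def Fn : ℕ → Formula
  | 0 => betaF
  | n + 1 => .limp (.atom (n + 1)) (Fn n)

/-- The context formula associated with the variable `xᵢ`: `αᵢ` if `xᵢ ∈ I`
(the variable has already been tested), and `αᵢ ⊕ᵢ αᵢ` otherwise. -/
def cFor (I : Finset ℕ) (i : ℕ) : Formula :=
  if i ∈ I then .atom i else .oplus i (.atom i) (.atom i)

/-- The list `[c(a+m), c(a+m-1), …, c(a+1)]` of context formulas for the variables
`x_{a+m}, …, x_{a+1}` (in decreasing order of indices). -/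
def csSeg (I : Finset ℕ) (a : ℕ) : ℕ → List Formula
  | 0 => []
  | m + 1 => cFor I (m + 1 + a) :: csSeg I a m

/-- The context `Γₙ(I)`: the formulas `cFor I i` for `i = n, …, 1` followed by `Fₙ`. -/
def encCtx (n : ℕ) (I : Finset ℕ) : List Formula := csSeg I 0 n ++ [Fn n]

lemma csSeg_split (I : Finset ℕ) (a m₁ m₂ : ℕ) :
    csSeg I a (m₁ + m₂) = csSeg I (a + m₁) m₂ ++ csSeg I a m₁ := by
  induction m₂ with
  | zero => simp [csSeg]
  | succ m ih =>
      have h : m + 1 + (a + m₁) = m₁ + m + 1 + a := by omega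
      show csSeg I a (m₁ + m + 1) = csSeg I (a + m₁) (m + 1) ++ csSeg I a m₁
      rw [csSeg, csSeg, h, ih]
      rfl

lemma cFor_insert_of_ne (I : Finset ℕ) {k i : ℕ} (h : i ≠ k) :
    cFor (insert k I) i = cFor I i := by
  simp [cFor, Finset.mem_insert, h]

lemma csSeg_insert (I : Finset ℕ) (k a : ℕ) :
    ∀ m : ℕ, (k ≤ a ∨ a + m < k) → csSeg (insert k I) a m = csSeg I a m := by
  intro m
  induction m with
  | zero => intro _; rfl
  | succ m ih =>
      intro h
      rw [csSeg, csSeg, cFor_insert_of_ne I (by omega), ih (by omega)]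

lemma csSeg_split_at (I : Finset ℕ) {n k : ℕ} (h1 : 1 ≤ k) (h2 : k ≤ n) :
    csSeg I 0 n = csSeg I k (n - k) ++ cFor I k :: csSeg I 0 (k - 1) := by
  obtain ⟨m, rfl⟩ : ∃ m, k = m + 1 := ⟨k - 1, by omega⟩
  have hn : n = (m + 1) + (n - (m + 1)) := by omega
  conv_lhs => rw [hn]
  rw [csSeg_split I 0 (m + 1) (n - (m + 1)), Nat.zero_add]
  simp [csSeg]

lemma csSeg_insert_split (I : Finset ℕ) {n k : ℕ} (h1 : 1 ≤ k) (h2 : k ≤ n)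
    (h3 : k ∉ I) :
    csSeg (insert k I) 0 n =
      csSeg I k (n - k) ++ Formula.atom k :: csSeg I 0 (k - 1) := by
  rw [csSeg_split_at (insert k I) h1 h2, csSeg_insert I k k (n - k) (Or.inl le_rfl),
    csSeg_insert I k 0 (k - 1) (Or.inr (by omega))]
  congr 1
  simp [cFor]

/-- The proof `β ⊢ 𝔹` selecting the left (`b = 1`) or right (`b = 0`) copy of `β`. -/
def pib : Bool → Proof [betaF] boolF
  | true => .oplusR1 0 (.ax 0)
  | false => .oplusR2 0 (.ax 0)

/-- The proof `νᵢ` of `cFor I i ⊢ αᵢ`: an axiom if `i ∈ I`, and the `⊕†ᵢ` combination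
of two axioms otherwise. -/
def nuFor (I : Finset ℕ) (i : ℕ) : Proof [cFor I i] (.atom i) :=
  if h : i ∈ I then
    Proof.castL (by simp [cFor, h]) (Proof.ax i)
  else
    Proof.castL (by simp [cFor, h]) (Proof.oplusL i (Γ := []) (Proof.ax i) (Proof.ax i))

/-- The chain of `⊸*` rules decomposing `Fₙ` against the subproofs `νᵢ`, ending in
`π_b`; the conclusion is `Fₙ, cₙ, …, c₁ ⊢ 𝔹`. -/
def leafChain (I : Finset ℕ) (b : Bool) : (n : ℕ) → Proof (Fn n :: csSeg I 0 n) boolF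
  | 0 => pib b
  | j + 1 =>
      Proof.ex [] [] (csSeg I 0 j) (cFor I (j + 1)) (Fn (j + 1))
        (Proof.limpL (Γ := [cFor I (j + 1)]) (nuFor I (j + 1)) (leafChain I b j))

/-- Moving the formula `A` to the end of the context, by a sequence of exchange rules. -/
def moveLast {C A : Formula} :
    (L M : List Formula) → Proof (L ++ A :: M) C → Proof ((L ++ M) ++ [A]) C
  | L, [], p => Proof.castL (by simp) p
  | L, B :: M, p =>
      let p' : Proof ((L ++ [B]) ++ A :: M) C :=
        Proof.castL (by simp) (Proof.ex L [] M A B p)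
      Proof.castL (by simp) (moveLast (L ++ [B]) M p')

/-- The translation of a leaf labeled `b`, with free variables `I`:
the chain of `⊸*` rules, with `Fₙ` moved back to the end of the context. -/
def encLeaf (n : ℕ) (I : Finset ℕ) (b : Bool) : Proof (encCtx n I) boolF :=
  moveLast [] (csSeg I 0 n) (leafChain I b n)

lemma encCtx_insert_eq (I : Finset ℕ) {n k : ℕ} (h1 : 1 ≤ k) (h2 : k ≤ n) (h3 : k ∉ I) :
    encCtx n (insert k I) =
      csSeg I k (n - k) ++ Formula.atom k :: (csSeg I 0 (k - 1) ++ [Fn n]) := by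
  rw [encCtx, csSeg_insert_split I h1 h2 h3]
  simp

lemma encCtx_eq (I : Finset ℕ) {n k : ℕ} (h1 : 1 ≤ k) (h2 : k ≤ n) (h3 : k ∉ I) :
    csSeg I k (n - k) ++
        Formula.oplus k (.atom k) (.atom k) :: (csSeg I 0 (k - 1) ++ [Fn n]) =
      encCtx n I := by
  rw [encCtx, csSeg_split_at I h1 h2]
  simp [cFor, h3]

/-- One premise of the `⊕†ₖ` rule in the translation of an internal vertex: the
translation of the subtree, with `αₖ` exchanged with `Fₙ` so as to sit at the end
of the context. -/
def encNodeArm (n k : ℕ) (I : Finset ℕ) (h1 : 1 ≤ k) (h2 : k ≤ n) (h3 : k ∉ I)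
    (p : Proof (encCtx n (insert k I)) boolF) :
    Proof ((csSeg I k (n - k) ++ Fn n :: csSeg I 0 (k - 1)) ++ [Formula.atom k]) boolF :=
  Proof.castL (by simp)
    (Proof.ex (csSeg I k (n - k)) (csSeg I 0 (k - 1)) [] (Formula.atom k) (Fn n)
      (Proof.castL (encCtx_insert_eq I h1 h2 h3) p))

/-- The translation of an internal vertex `(x_k ? φ₀ : φ₁)` with free variables `I`
from the translations of `φ₀` and `φ₁` (with free variables `I ∪ {x_k}`): exchange
`αₖ` with `Fₙ`, apply the `⊕†ₖ` rule, and exchange back. -/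
def encNode (n k : ℕ) (I : Finset ℕ) (h1 : 1 ≤ k) (h2 : k ≤ n) (h3 : k ∉ I)
    (p₀ p₁ : Proof (encCtx n (insert k I)) boolF) : Proof (encCtx n I) boolF :=
  Proof.castL (encCtx_eq I h1 h2 h3)
    (Proof.ex (csSeg I k (n - k)) (csSeg I 0 (k - 1)) []
      (Fn n) (Formula.oplus k (.atom k) (.atom k))
      (Proof.castL (by simp)
        (Proof.oplusL k (Γ := csSeg I k (n - k) ++ Fn n :: csSeg I 0 (k - 1))
          (encNodeArm n k I h1 h2 h3 p₀) (encNodeArm n k I h1 h2 h3 p₁))))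

/-- The translation `⟦φ⟧` of a BDT `φ` (over the variables `x₁, …, xₙ`, with free
variables `I`) as a proof of `Γₙ(I) ⊢ 𝔹`. -/
def encAux (n : ℕ) : BDT → (I : Finset ℕ) → Proof (encCtx n I) boolF
  | .leaf b, I => encLeaf n I b
  | .node k φ₀ φ₁, I =>
      if h : 1 ≤ k ∧ k ≤ n ∧ k ∉ I then
        encNode n k I h.1 h.2.1 h.2.2
          (encAux n φ₀ (insert k I)) (encAux n φ₁ (insert k I))
      else encLeaf n I false

/-- The encoding `⟦φ⟧ : Γₙ(∅) ⊢ 𝔹` of a BDT `φ` over the variables `x₁, …, xₙ`. -/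
def enc (n : ℕ) (φ : BDT) : Proof (encCtx n ∅) boolF := encAux n φ ∅

lemma csz_nil : csz [] = 0 := rfl

lemma csz_cons (A : Formula) (Γ : List Formula) : csz (A :: Γ) = A.size + csz Γ := by
  simp [csz]

lemma csz_append (Γ Δ : List Formula) : csz (Γ ++ Δ) = csz Γ + csz Δ := by
  simp [csz]

lemma Fn_size (n : ℕ) : (Fn n).size = n + 1 := by
  induction n with
  | zero => rfl
  | succ n ih => rw [Fn, Formula.size, ih, Formula.size]; omega

lemma cFor_size (I : Finset ℕ) (i : ℕ) : (cFor I i).size = if i ∈ I then 1 else 2 := by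
  unfold cFor
  split_ifs <;> rfl

lemma Proof.castL_bdt {Γ Γ' : List Formula} {C : Formula} (h : Γ = Γ') (p : Proof Γ C) :
    (Proof.castL h p).bdt = p.bdt := by
  subst h
  rfl

lemma moveLast_bdt {C A : Formula} (L M : List Formula) (p : Proof (L ++ A :: M) C) (i j : ℕ) :
    (moveLast L M p).bdt i j =
      p.bdt (swapMap (csz L) (csz M) 0 A.size i) (swapMap (csz L) (csz M) 0 A.size j) := by
  induction M generalizing L with
  | nil =>
    have h : ∀ t, swapMap (csz L) 0 0 A.size t = t := by
      intro t
      unfold swapMap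
      split_ifs <;> omega
    rw [moveLast, Proof.castL_bdt, csz_nil, h, h]
  | cons B M ih =>
    have h : ∀ t, swapMap (csz L) B.size 0 A.size
        (swapMap (csz L + B.size) (csz M) 0 A.size t) =
        swapMap (csz L) (B.size + csz M) 0 A.size t := by
      intro t
      unfold swapMap
      split_ifs <;> omega
    simp only [moveLast, Proof.castL_bdt, ih, Proof.bdt, csz_append, csz_cons, csz_nil,
      Nat.add_zero, h]

/-- The BDT at the copy `d` of `αᵢ` and the output atom `αᵢ` in the encoding with
free variables `I`, up to equivalence. -/
def nuBdt (I : Finset ℕ) (i d : ℕ) : BDT :=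
  if i ∈ I then .leaf true else .node i (.leaf (d == 0)) (.leaf (d == 1))

lemma nuFor_bdt (I : Finset ℕ) (i d : ℕ) (hd : d < (cFor I i).size) :
    (nuFor I i).bdt d (cFor I i).size = nuBdt I i d := by
  rw [cFor_size] at *
  unfold nuFor nuBdt
  split_ifs with h
  · rw [if_pos h] at hd
    obtain rfl : d = 0 := by omega
    simp [Proof.castL_bdt, Proof.bdt]
  · rw [if_neg h] at hd
    obtain rfl | rfl : d = 0 ∨ d = 1 := by omega
    all_goals simp [Proof.castL_bdt, Proof.bdt, csz_nil, Formula.size]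

lemma leafChain_bdt_beta (I : Finset ℕ) (b : Bool) (n d : ℕ) (hd : d < 2) :
    (leafChain I b n).bdt n (n + 1 + csz (csSeg I 0 n) + d) =
      .leaf (if d = 0 then b else !b) := by
  induction n with
  | zero =>
    obtain rfl | rfl : d = 0 ∨ d = 1 := by omega
    all_goals cases b <;>
      simp [leafChain, pib, Proof.bdt, csSeg, csz_nil, csz_cons, Fn, betaF, Formula.size]
  | succ n ih =>
    have h1 : swapMap 0 (n + 2) 0 (cFor I (n + 1)).size (n + 1) =
        (cFor I (n + 1)).size + 1 + n := by
      unfold swapMap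
      split_ifs <;> omega
    have h2 : swapMap 0 (n + 2) 0 (cFor I (n + 1)).size
        (n + 1 + 1 + ((cFor I (n + 1)).size + csz (csSeg I 0 n)) + d) =
        (cFor I (n + 1)).size + 1 + (n + 1 + csz (csSeg I 0 n) + d) := by
      unfold swapMap
      split_ifs <;> omega
    simp only [leafChain, Proof.bdt, csSeg, csz_cons, csz_nil, Fn_size, Nat.add_zero, h1, h2,
      Formula.size]
    rw [if_neg (by omega), if_pos (by omega), Nat.add_sub_cancel_left, Nat.add_sub_cancel_left, ih]

lemma leafChain_bdt_alpha (I : Finset ℕ) (b : Bool) (n i d : ℕ) (hi : 1 ≤ i) (hin : i ≤ n)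
    (hd : d < (cFor I i).size) :
    (leafChain I b n).bdt (n + 1 + csz (csSeg I i (n - i)) + d) (n - i) = nuBdt I i d := by
  induction n with
  | zero => omega
  | succ n ih =>
    obtain rfl | hlt := eq_or_lt_of_le hin
    · have h1 : swapMap 0 (n + 2) 0 (cFor I (n + 1)).size (n + 1 + 1 + d) = d := by
        unfold swapMap
        split_ifs <;> omega
      have h2 : swapMap 0 (n + 2) 0 (cFor I (n + 1)).size 0 = (cFor I (n + 1)).size := by
        unfold swapMap
        split_ifs <;> omega
      simp only [leafChain, Proof.bdt, csSeg, csz_cons, csz_nil, Fn_size, Nat.add_zero, h1, h2,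
        Formula.size, Nat.sub_self]
      rw [if_pos (by omega), nuFor_bdt I _ d hd]
    · have e : n + 1 - i = n - i + 1 := by omega
      have e' : n - i + 1 + i = n + 1 := by omega
      have h1 : swapMap 0 (n + 2) 0 (cFor I (n + 1)).size
          (n + 1 + 1 + ((cFor I (n + 1)).size + csz (csSeg I i (n - i))) + d) =
          (cFor I (n + 1)).size + 1 + (n + 1 + csz (csSeg I i (n - i)) + d) := by
        unfold swapMap
        split_ifs <;> omega
      have h2 : swapMap 0 (n + 2) 0 (cFor I (n + 1)).size (n - i + 1) =
          (cFor I (n + 1)).size + 1 + (n - i) := by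
        unfold swapMap
        split_ifs <;> omega
      simp only [leafChain, Proof.bdt, e, csSeg, e', csz_cons, csz_nil, Fn_size, Nat.add_zero,
        h1, h2, Formula.size]
      rw [if_neg (by omega), if_pos (by omega), Nat.add_sub_cancel_left, Nat.add_sub_cancel_left,
        ih (by omega)]

/-- The size of a context segment splits at a variable. -/
lemma csz_csSeg_split_at (I : Finset ℕ) {n i k : ℕ} (h1 : i < k) (h2 : k ≤ n) :
    csz (csSeg I i (n - i)) =
      csz (csSeg I k (n - k)) + (cFor I k).size + csz (csSeg I i (k - 1 - i)) := by
  have e : n - i = (k - 1 - i + 1) + (n - k) := by omega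
  have e1 : i + (k - 1 - i + 1) = k := by omega
  have e2 : k - 1 - i + 1 + i = k := by omega
  rw [e, csSeg_split, e1, csSeg, e2, csz_append, csz_cons]
  omega

lemma encLeaf_bdt_beta (n : ℕ) (I : Finset ℕ) (b : Bool) (d : ℕ) (hd : d < 2) :
    (encLeaf n I b).bdt (csz (csSeg I 0 n) + n) (csz (csSeg I 0 n) + n + 1 + d) =
      .leaf (if d = 0 then b else !b) := by
  have h1 : swapMap 0 (csz (csSeg I 0 n)) 0 (n + 1) (csz (csSeg I 0 n) + n) = n := by
    unfold swapMap
    split_ifs <;> omega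
  have h2 : swapMap 0 (csz (csSeg I 0 n)) 0 (n + 1) (csz (csSeg I 0 n) + n + 1 + d) =
      n + 1 + csz (csSeg I 0 n) + d := by
    unfold swapMap
    split_ifs <;> omega
  refine (moveLast_bdt [] (csSeg I 0 n) (leafChain I b n) _ _).trans ?_
  rw [Fn_size, csz_nil, h1, h2]
  exact leafChain_bdt_beta I b n d hd

lemma encLeaf_bdt_alpha (n : ℕ) (I : Finset ℕ) (b : Bool) (i d : ℕ) (hi : 1 ≤ i) (hin : i ≤ n)
    (hd : d < (cFor I i).size) :
    (encLeaf n I b).bdt (csz (csSeg I i (n - i)) + d) (csz (csSeg I 0 n) + (n - i)) =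
      nuBdt I i d := by
  have hs := csz_csSeg_split_at I (i := 0) hi hin
  rw [Nat.sub_zero] at hs
  have h1 : swapMap 0 (csz (csSeg I 0 n)) 0 (n + 1) (csz (csSeg I i (n - i)) + d) =
      n + 1 + csz (csSeg I i (n - i)) + d := by
    unfold swapMap
    split_ifs <;> omega
  have h2 : swapMap 0 (csz (csSeg I 0 n)) 0 (n + 1) (csz (csSeg I 0 n) + (n - i)) = n - i := by
    unfold swapMap
    split_ifs <;> omega
  refine (moveLast_bdt [] (csSeg I 0 n) (leafChain I b n) _ _).trans ?_
  rw [Fn_size, csz_nil, h1, h2]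
  exact leafChain_bdt_alpha I b n i d hi hin hd

/-- The reindexing `Γₙ(I) → Γₙ(I ∪ {xₖ})` of positions, collapsing the two atoms of
`αₖ ⊕ₖ αₖ`, which start at position `a`, to one. -/
def armMap (a t : ℕ) : ℕ := if t ≤ a then t else t - 1

section EncNode

variable {n k : ℕ} {I : Finset ℕ} (h1 : 1 ≤ k) (h2 : k ≤ n) (h3 : k ∉ I)
  (p₀ p₁ : Proof (encCtx n (insert k I)) boolF)

lemma encNodeArm_bdt (p : Proof (encCtx n (insert k I)) boolF) (i j : ℕ) :
    (encNodeArm n k I h1 h2 h3 p).bdt i j =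
      p.bdt (swapMap (csz (csSeg I k (n - k))) (n + 1) (csz (csSeg I 0 (k - 1))) 1 i)
        (swapMap (csz (csSeg I k (n - k))) (n + 1) (csz (csSeg I 0 (k - 1))) 1 j) := by
  simp only [encNodeArm, Proof.castL_bdt, Proof.bdt, Fn_size, Formula.size]

lemma swapMap_two_cases (a z n t : ℕ) :
    t < a ∧ swapMap a 2 z (n + 1) t = t ∨
    a ≤ t ∧ t < a + 2 ∧ swapMap a 2 z (n + 1) t = t + (n + 1 + z) ∨
    a + 2 ≤ t ∧ t < a + 2 + z ∧ swapMap a 2 z (n + 1) t = t + n - 1 ∨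
    a + 2 + z ≤ t ∧ t < a + 2 + z + (n + 1) ∧ swapMap a 2 z (n + 1) t = t - 2 - z ∨
    a + 2 + z + (n + 1) ≤ t ∧ swapMap a 2 z (n + 1) t = t := by
  unfold swapMap
  split_ifs <;> omega

lemma armMap_left (a z n t : ℕ) :
    swapMap a (n + 1) z 1
      (if swapMap a 2 z (n + 1) t < a + (n + 1 + z) + 1 then swapMap a 2 z (n + 1) t
        else swapMap a 2 z (n + 1) t - 1) = armMap a t := by
  have h := swapMap_two_cases a z n t
  generalize swapMap a 2 z (n + 1) t = s at *
  have hu : ∃ u, (if s < a + (n + 1 + z) + 1 then s else s - 1) = u ∧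
      (s < a + (n + 1 + z) + 1 ∧ u = s ∨ a + (n + 1 + z) + 1 ≤ s ∧ u = s - 1) := by
    refine ⟨_, rfl, ?_⟩
    split_ifs <;> omega
  obtain ⟨u, hu, h'⟩ := hu
  rw [hu]
  unfold swapMap armMap
  rcases h with h | h | h | h | h <;> split_ifs <;> omega

lemma armMap_right (a z n t : ℕ) (ht : t ≠ a) :
    swapMap a (n + 1) z 1
      (if swapMap a 2 z (n + 1) t < a + (n + 1 + z) then swapMap a 2 z (n + 1) t
        else swapMap a 2 z (n + 1) t - 1) = armMap a t := by
  have h := swapMap_two_cases a z n t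
  generalize swapMap a 2 z (n + 1) t = s at *
  have hu : ∃ u, (if s < a + (n + 1 + z) then s else s - 1) = u ∧
      (s < a + (n + 1 + z) ∧ u = s ∨ a + (n + 1 + z) ≤ s ∧ u = s - 1) := by
    refine ⟨_, rfl, ?_⟩
    split_ifs <;> omega
  obtain ⟨u, hu, h'⟩ := hu
  rw [hu]
  unfold swapMap armMap
  rcases h with h | h | h | h | h <;> split_ifs <;> omega

lemma swapMap_two_eq_iff_left (a z n t : ℕ) :
    a + (n + 1 + z) ≤ swapMap a 2 z (n + 1) t ∧ swapMap a 2 z (n + 1) t < a + (n + 1 + z) + 1 ↔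
      t = a := by
  unfold swapMap
  split_ifs <;> omega

lemma swapMap_two_eq_iff_right (a z n t : ℕ) :
    a + (n + 1 + z) + 1 ≤ swapMap a 2 z (n + 1) t ∧
      swapMap a 2 z (n + 1) t < a + (n + 1 + z) + 1 + 1 ↔ t = a + 1 := by
  unfold swapMap
  split_ifs <;> omega

lemma encNode_bdt (i j : ℕ) (hj : j ≠ csz (csSeg I k (n - k)))
    (hj' : j ≠ csz (csSeg I k (n - k)) + 1) :
    (encNode n k I h1 h2 h3 p₀ p₁).bdt i j =
      .node k
        (if i = csz (csSeg I k (n - k)) + 1 then .leaf false else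
          p₀.bdt (armMap (csz (csSeg I k (n - k))) i) (armMap (csz (csSeg I k (n - k))) j))
        (if i = csz (csSeg I k (n - k)) then .leaf false else
          p₁.bdt (armMap (csz (csSeg I k (n - k))) i) (armMap (csz (csSeg I k (n - k))) j)) := by
  simp only [encNode, Proof.castL_bdt, Proof.bdt, encNodeArm_bdt, Fn_size, Formula.size,
    csz_append, csz_cons, swapMap_two_eq_iff_left, swapMap_two_eq_iff_right, Nat.reduceAdd]
  generalize csz (csSeg I k (n - k)) = a at *
  generalize csz (csSeg I 0 (k - 1)) = z at *
  rw [armMap_left a z n j, armMap_right a z n j hj]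
  by_cases hi : i = a
  · subst hi
    rw [armMap_left i z n i]
    simp [hj, hj']
  · by_cases hi' : i = a + 1
    · subst hi'
      rw [armMap_right a z n (a + 1) (by omega)]
      simp [hj, hj']
    · rw [armMap_left a z n i, armMap_right a z n i hi]
      simp [hj, hj', hi, hi']

end EncNode

lemma csz_csSeg_eq (I : Finset ℕ) {n k : ℕ} (h1 : 1 ≤ k) (h2 : k ≤ n) (h3 : k ∉ I) :
    csz (csSeg I 0 n) = csz (csSeg I k (n - k)) + 2 + csz (csSeg I 0 (k - 1)) := by
  have h := csz_csSeg_split_at I (i := 0) h1 h2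
  simpa [cFor_size, h3] using h

lemma csz_csSeg_insert_succ (I : Finset ℕ) {n i k : ℕ} (h1 : i < k) (h2 : k ≤ n) (h3 : k ∉ I) :
    csz (csSeg (insert k I) i (n - i)) + 1 = csz (csSeg I i (n - i)) := by
  rw [csz_csSeg_split_at _ h1 h2, csz_csSeg_split_at I h1 h2, csSeg_insert I k k _ (by omega),
    csSeg_insert I k i _ (by omega), cFor_size, cFor_size, if_pos (by simp), if_neg h3]
  omega

lemma encAux_bdt_beta (n : ℕ) (φ : BDT) (hfree : φ.Free) (I : Finset ℕ)
    (hvars : ∀ x ∈ φ.vars, 1 ≤ x ∧ x ≤ n ∧ x ∉ I) (d : ℕ) (hd : d < 2) :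
    (encAux n φ I).bdt (csz (csSeg I 0 n) + n) (csz (csSeg I 0 n) + n + 1 + d) =
      if d = 0 then φ else φ.neg := by
  induction φ generalizing I with
  | leaf b =>
    rw [encAux, encLeaf_bdt_beta n I b d hd, BDT.neg]
    split_ifs <;> rfl
  | node k φ₀ φ₁ ih₀ ih₁ =>
    obtain ⟨hk₀, hk₁, hf₀, hf₁⟩ := hfree
    have hk := hvars k (by simp [BDT.vars])
    have hs := csz_csSeg_eq I hk.1 hk.2.1 hk.2.2
    have hs' := csz_csSeg_insert_succ I (i := 0) hk.1 hk.2.1 hk.2.2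
    rw [Nat.sub_zero] at hs'
    have hv₀ : ∀ x ∈ φ₀.vars, 1 ≤ x ∧ x ≤ n ∧ x ∉ insert k I := by
      intro x hx
      have hv := hvars x (by simp [BDT.vars, hx])
      refine ⟨hv.1, hv.2.1, ?_⟩
      rw [Finset.mem_insert, not_or]
      exact ⟨fun h => hk₀ (h ▸ hx), hv.2.2⟩
    have hv₁ : ∀ x ∈ φ₁.vars, 1 ≤ x ∧ x ≤ n ∧ x ∉ insert k I := by
      intro x hx
      have hv := hvars x (by simp [BDT.vars, hx])
      refine ⟨hv.1, hv.2.1, ?_⟩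
      rw [Finset.mem_insert, not_or]
      exact ⟨fun h => hk₁ (h ▸ hx), hv.2.2⟩
    have e1 : armMap (csz (csSeg I k (n - k))) (csz (csSeg I 0 n) + n) =
        csz (csSeg (insert k I) 0 n) + n := by
      unfold armMap
      split_ifs <;> omega
    have e2 : armMap (csz (csSeg I k (n - k))) (csz (csSeg I 0 n) + n + 1 + d) =
        csz (csSeg (insert k I) 0 n) + n + 1 + d := by
      unfold armMap
      split_ifs <;> omega
    rw [encAux, dif_pos hk, encNode_bdt _ _ _ _ _ _ _ (by omega) (by omega), if_neg (by omega),
      if_neg (by omega), e1, e2, ih₀ hf₀ _ hv₀, ih₁ hf₁ _ hv₁, BDT.neg]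
    split_ifs <;> rfl

lemma encAux_bdt_alpha (n : ℕ) (φ : BDT) (I : Finset ℕ) (i : ℕ) (hi : 1 ≤ i) (hin : i ≤ n)
    (d : ℕ) (hd : d < (cFor I i).size) :
    BDT.Equiv
      ((encAux n φ I).bdt (csz (csSeg I i (n - i)) + d) (csz (csSeg I 0 n) + (n - i)))
      (nuBdt I i d) := by
  induction φ generalizing I d with
  | leaf b =>
    intro v
    rw [encAux, encLeaf_bdt_alpha n I b i d hi hin hd]
  | node k φ₀ φ₁ ih₀ ih₁ =>
    intro v
    by_cases hk : 1 ≤ k ∧ k ≤ n ∧ k ∉ I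
    swap
    · rw [encAux, dif_neg hk, encLeaf_bdt_alpha n I false i d hi hin hd]
    have hs := csz_csSeg_eq I hk.1 hk.2.1 hk.2.2
    have hs' := csz_csSeg_insert_succ I (i := 0) hk.1 hk.2.1 hk.2.2
    rw [Nat.sub_zero] at hs'
    have e2 : armMap (csz (csSeg I k (n - k))) (csz (csSeg I 0 n) + (n - i)) =
        csz (csSeg (insert k I) 0 n) + (n - i) := by
      unfold armMap
      split_ifs <;> omega
    rw [encAux, dif_pos hk, encNode_bdt _ _ _ _ _ _ _ (by omega) (by omega), e2, BDT.eval]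
    by_cases hik : i = k
    · subst hik
      have hsz : (cFor (insert i I) i).size = 1 := by simp [cFor_size]
      have g₀ := ih₀ (insert i I) 0 (by omega) v
      have g₁ := ih₁ (insert i I) 0 (by omega) v
      rw [csSeg_insert I i i _ (by omega), Nat.add_zero] at g₀ g₁
      rw [cFor_size, if_neg hk.2.2] at hd
      obtain rfl | rfl : d = 0 ∨ d = 1 := by omega
      · simp [armMap, nuBdt, g₀, hk.2.2, BDT.eval]
      · simp [armMap, nuBdt, g₁, hk.2.2, BDT.eval]
    · have hsz : (cFor (insert k I) i).size = (cFor I i).size := by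
        rw [cFor_insert_of_ne I hik]
      have hnu : nuBdt (insert k I) i d = nuBdt I i d := by
        simp [nuBdt, hik]
      have key : csz (csSeg I i (n - i)) + d ≠ csz (csSeg I k (n - k)) ∧
          csz (csSeg I i (n - i)) + d ≠ csz (csSeg I k (n - k)) + 1 ∧
          armMap (csz (csSeg I k (n - k))) (csz (csSeg I i (n - i)) + d) =
            csz (csSeg (insert k I) i (n - i)) + d := by
        obtain hlt | hlt := lt_or_gt_of_ne hik
        · have a1 := csz_csSeg_split_at I hlt hk.2.1
          have a2 := csz_csSeg_insert_succ I hlt hk.2.1 hk.2.2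
          rw [cFor_size, if_neg hk.2.2] at a1
          unfold armMap
          split_ifs <;> omega
        · have a1 := csz_csSeg_split_at I hlt hin
          rw [csSeg_insert I k i _ (by omega)]
          unfold armMap
          split_ifs <;> omega
      rw [if_neg key.2.1, if_neg key.1, key.2.2, ih₀ _ d (by omega), ih₁ _ d (by omega), hnu,
        ite_self]

lemma csz_csSeg_empty (a m : ℕ) : csz (csSeg ∅ a m) = 2 * m := by
  induction m with
  | zero => rfl
  | succ m ih =>
    rw [csSeg, csz_cons, ih, cFor_size, if_neg (Finset.notMem_empty _)]
    omega

lemma Proof.bdtAt_of_le {Γ : List Formula} {C : Formula} (π : Proof Γ C) {i j : ℕ} (h : i ≤ j) :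
    π.bdtAt s(i, j) = π.bdt i j := by
  simp [Proof.bdtAt, pmin, pmax, h]

/-- **Representation lemma.**  Let `φ` be a free BDT over the variables `x₁, …, xₙ`
and let `B = B(⟦φ⟧)` be the BDT slicing of its λ⊕⊸ encoding.  In the flattening of the
conclusion sequent `Γₙ(∅) ⊢ 𝔹`, the occurrence `β` of `Fₙ` sits at position `3n`, the
copies `β^l`, `β^r` of `𝔹` at positions `3n + 1`, `3n + 2`, the copies `αᵢ^l`, `αᵢ^r`
of `αᵢ ⊕ᵢ αᵢ` at positions `2(n - i)`, `2(n - i) + 1`, and the occurrence `αᵢ^⊸` of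
`Fₙ` at position `3n - i`.  Then: (i) `B[β, β^l] = φ`; (ii) `B[β, β^r] = φ̄`;
(iii) `B[αᵢ^l, αᵢ^⊸] ∼ (xᵢ ? 1 : 0)`; and (iv) `B[αᵢ^r, αᵢ^⊸] ∼ (xᵢ ? 0 : 1)`. -/
theorem enc_bdt_slicing_representation
    (n : ℕ) (φ : BDT) (hfree : φ.Free) (hvars : ∀ x ∈ φ.vars, 1 ≤ x ∧ x ≤ n) :
    (enc n φ).bdtAt s(3 * n, 3 * n + 1) = φ ∧
    (enc n φ).bdtAt s(3 * n, 3 * n + 2) = φ.neg ∧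
    (∀ i : ℕ, 1 ≤ i → i ≤ n →
      BDT.Equiv ((enc n φ).bdtAt s(2 * (n - i), 3 * n - i))
        (.node i (.leaf true) (.leaf false))) ∧
    (∀ i : ℕ, 1 ≤ i → i ≤ n →
      BDT.Equiv ((enc n φ).bdtAt s(2 * (n - i) + 1, 3 * n - i))
        (.node i (.leaf false) (.leaf true))) := by
  have hv : ∀ x ∈ φ.vars, 1 ≤ x ∧ x ≤ n ∧ x ∉ (∅ : Finset ℕ) := fun x hx =>
    ⟨(hvars x hx).1, (hvars x hx).2, Finset.notMem_empty x⟩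
  have hb := encAux_bdt_beta n φ hfree ∅ hv
  have e : 2 * n + n = 3 * n := by omega
  rw [csz_csSeg_empty, e] at hb
  have ha : ∀ i, 1 ≤ i → i ≤ n → ∀ d < 2,
      BDT.Equiv ((enc n φ).bdtAt s(2 * (n - i) + d, 3 * n - i)) (nuBdt ∅ i d) := by
    intro i hi hin d hd
    have h := encAux_bdt_alpha n φ ∅ i hi hin d (by simpa [cFor_size] using hd)
    have e' : 2 * n + (n - i) = 3 * n - i := by omega
    rw [csz_csSeg_empty, csz_csSeg_empty, e'] at h
    rw [Proof.bdtAt_of_le _ (by omega)]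
    exact h
  refine ⟨?_, ?_, fun i hi hin => ?_, fun i hi hin => ?_⟩
  · rw [Proof.bdtAt_of_le _ (by omega)]
    exact hb 0 (by omega)
  · rw [Proof.bdtAt_of_le _ (by omega)]
    exact hb 1 (by omega)
  · exact ha i hi hin 0 (by omega)
  · exact ha i hi hin 1 (by omega)
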